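/- Let Ω ⊆ ℝ² be open, let R > 0, and let κ > 0 be a constant such that for every locally absolutely continuous function w on (0,R] with w(R) = 0 one has κ·∫_0^R w(ρ)² ρ dρ ≤ ∫_0^R w′(ρ)² ρ dρ (the best such κ is (j_0/R)², where j_0 is the first positive root of the Bessel function J_0). Then for every u ∈ C_0^∞(Ω), writing N_t = {x ∈ Ω : |u(x)| ≥ t}, one has π · κ · R² · ∫_0^∞ exp( −4π / cap(N_t;Ω) ) · 2t dt ≤ ∫_Ω |∇u|² dx. -/

import Mathlib

open MeasureTheory Metric Set Filter Real
open scoped ENNReal Topology MeasureTheory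

noncomputable section

/-- Smooth compactly supported test function in an open set `Ω`. -/
def TestFun (Ω : Set (EuclideanSpace ℝ (Fin 2)))
    (u : EuclideanSpace ℝ (Fin 2) → ℝ) : Prop :=
  ContDiff ℝ (⊤ : ℕ∞) u ∧ HasCompactSupport u ∧ tsupport u ⊆ Ω

/-- Relative harmonic capacity
`cap(F;Ω) = inf { ∫_Ω |∇u|² : u ∈ C_0^∞(Ω), u ≥ 1 on F }`. -/
def harmCap (F Ω : Set (EuclideanSpace ℝ (Fin 2))) : ℝ :=
  sInf {r : ℝ | ∃ u : EuclideanSpace ℝ (Fin 2) → ℝ, TestFun Ω u ∧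
    (∀ x ∈ F, 1 ≤ u x) ∧ r = ∫ x in Ω, ‖fderiv ℝ u x‖ ^ 2}

theorem sum_indicator_sq_of_pairwise_disjoint {α ι : Type*} (s : Finset ι) (A : ι → Set α)
    (hA : Pairwise (fun i j => Disjoint (A i) (A j))) (f : ι → α → ℝ) (x : α) :
    (∑ i ∈ s, (A i).indicator (f i) x) ^ 2 = ∑ i ∈ s, (A i).indicator (fun y => f i y ^ 2) x := by
  by_cases h : ∃ j ∈ s, x ∈ A j
  · obtain ⟨j, hj, hx⟩ := h
    have hne : ∀ i ∈ s, i ≠ j → x ∉ A i := fun i _ hij hi =>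
      Set.disjoint_left.1 (hA hij) hi hx
    rw [Finset.sum_eq_single_of_mem j hj fun i hi hij => indicator_of_notMem (hne i hi hij) _,
      Finset.sum_eq_single_of_mem j hj fun i hi hij => indicator_of_notMem (hne i hi hij) _,
      indicator_of_mem hx, indicator_of_mem hx]
  · push Not at h
    rw [Finset.sum_eq_zero fun i hi => indicator_of_notMem (h i hi) _,
      Finset.sum_eq_zero fun i hi => indicator_of_notMem (h i hi) _]
    norm_num

theorem hardy_step_inequality {R κ : ℝ} (hR : 0 < R) (hκ : 0 < κ)
    (hHardy : ∀ w w' : ℝ → ℝ,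
      (∀ a b : ℝ, 0 < a → a ≤ b → b ≤ R →
        IntervalIntegrable w' volume a b ∧ w b - w a = ∫ s in a..b, w' s) →
      w R = 0 →
      ENNReal.ofReal κ * ∫⁻ ρ in Ioo (0:ℝ) R, ENNReal.ofReal (w ρ ^ 2 * ρ) ≤
        ∫⁻ ρ in Ioo (0:ℝ) R, ENNReal.ofReal (w' ρ ^ 2 * ρ))
    {Δ : ℝ} (hΔ : 0 < Δ) {h : ℕ → ℝ} (hh : ∀ i, 0 < h i) (n : ℕ) :
    π * κ * R ^ 2 * ∑ k ∈ Finset.range n, (2 * (k : ℝ) + 1) * Δ ^ 2 *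
        exp (-(4 * π) * ∑ i ∈ Finset.range (k + 1), Δ / h i) ≤
      ∑ i ∈ Finset.range n, Δ * h i := by
  have hπ := Real.pi_pos
  set ρ : ℕ → ℝ := fun k => R * exp (-(2 * π) * ∑ i ∈ Finset.range k, Δ / h i) with hρ
  have ρpos : ∀ k, 0 < ρ k := fun k => mul_pos hR (exp_pos _)
  have ρsucc : ∀ k, ρ (k + 1) = ρ k * exp (-(2 * π * (Δ / h k))) := by
    intro k
    simp only [hρ]
    rw [Finset.sum_range_succ, mul_assoc, ← exp_add]
    congr 2; ring
  have ρanti : Antitone ρ := by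
    refine antitone_nat_of_succ_le fun k => ?_
    rw [ρsucc]
    refine mul_le_of_le_one_right (ρpos k).le (exp_le_one_iff.2 ?_)
    have := div_pos hΔ (hh k)
    nlinarith [mul_pos hπ this]
  have ρle : ∀ k, ρ k ≤ R := fun k => by
    have := ρanti (Nat.zero_le k)
    simpa [hρ] using this
  have ρlog : ∀ k, log (ρ k / ρ (k + 1)) = 2 * π * (Δ / h k) := by
    intro k
    rw [ρsucc, exp_neg, ← div_div, div_self (ρpos k).ne', one_div, inv_inv, log_exp]
  set A : ℕ → Set ℝ := fun i => Ioc (ρ (i + 1)) (ρ i) with hA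
  have hAdisj : Pairwise (fun i j => Disjoint (A i) (A j)) := by
    simpa [Function.onFun] using ρanti.pairwise_disjoint_on_Ioc_succ
  have hAmeas : ∀ i, MeasurableSet (A i) := fun i => measurableSet_Ioc
  have hApos : ∀ i, ∀ s ∈ A i, 0 < s := fun i s hs => (ρpos _).trans hs.1
  have intInv : ∀ i, ∀ c : ℝ, IntegrableOn (fun s => c * s⁻¹) (A i) := by
    intro i c
    have : IntervalIntegrable (fun s : ℝ => c * s⁻¹) volume (ρ (i + 1)) (ρ i) := by
      refine (intervalIntegral.intervalIntegrable_inv (fun x hx => ?_) continuousOn_id).const_mul c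
      rw [uIcc_of_le (ρanti (Nat.le_succ i))] at hx
      exact ((ρpos _).trans_le hx.1).ne'
    exact (intervalIntegrable_iff_integrableOn_Ioc_of_le (ρanti (Nat.le_succ i))).1 this
  have intA : ∀ i, ∀ c : ℝ, ∫ s in A i, c * s⁻¹ = c * (2 * π * (Δ / h i)) := by
    intro i c
    rw [← intervalIntegral.integral_of_le (ρanti (Nat.le_succ i)),
      intervalIntegral.integral_const_mul, integral_inv_of_pos (ρpos _) (ρpos _), ρlog]
  set g : ℕ → ℝ → ℝ := fun i => (A i).indicator (fun s => h i / (2 * π) * s⁻¹) with hg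
  have gint : ∀ i, Integrable (g i) := fun i => (integrable_indicator_iff (hAmeas i)).2 (intInv i _)
  have gnn : ∀ i s, 0 ≤ g i s := fun i s => indicator_nonneg
    (fun s hs => mul_nonneg (div_nonneg (hh i).le (by positivity)) (inv_nonneg.2 (hApos i s hs).le)) s
  set v : ℝ → ℝ := fun s => ∑ i ∈ Finset.range n, g i s with hv
  have vint : Integrable v := integrable_finsetSum _ fun i _ => gint i
  set w : ℝ → ℝ := fun r => ∫ s in r..R, v s with hw
  have w_ge : ∀ m ≤ n, ∀ r ≤ ρ m, m * Δ ≤ w r := by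
    intro m hm r hr
    have h1 : w r = ∑ i ∈ Finset.range n, ∫ s in r..R, g i s :=
      intervalIntegral.integral_finsetSum fun i _ => (gint i).intervalIntegrable
    rw [h1]
    have hrR : r ≤ R := hr.trans (ρle m)
    calc (m : ℝ) * Δ = ∑ i ∈ Finset.range m, Δ := by simp
      _ = ∑ i ∈ Finset.range m, ∫ s in r..R, g i s := by
        refine Finset.sum_congr rfl fun i hi => ?_
        rw [intervalIntegral.integral_of_le hrR, setIntegral_indicator (hAmeas i),
          inter_eq_right.2, intA]
        · have := (hh i).ne'
          field_simp
        · refine Ioc_subset_Ioc ?_ (ρle i)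
          exact hr.trans (ρanti (Nat.succ_le_of_lt (Finset.mem_range.1 hi)))
      _ ≤ _ := Finset.sum_le_sum_of_subset_of_nonneg (by simpa using hm) fun i _ _ =>
        intervalIntegral.integral_nonneg hrR fun s _ => gnn i s
  have key := hHardy w (fun s => -v s) (fun a b _ _ _ => ⟨vint.neg.intervalIntegrable, by
      simp only [hw]
      rw [intervalIntegral.integral_neg, ← intervalIntegral.integral_add_adjacent_intervals
        (a := a) (b := b) (c := R) vint.intervalIntegrable vint.intervalIntegrable]
      ring⟩) (by simp [hw])
  have upper : ∫⁻ r in Ioo (0:ℝ) R, ENNReal.ofReal ((-v r) ^ 2 * r) ≤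
      ENNReal.ofReal (∑ i ∈ Finset.range n, Δ * h i / (2 * π)) := by
    have hterm : ∀ i, ∀ r ∈ A i, 0 ≤ (h i / (2 * π)) ^ 2 * r⁻¹ := fun i r hr =>
      mul_nonneg (sq_nonneg _) (inv_nonneg.2 (hApos i r hr).le)
    calc ∫⁻ r in Ioo (0:ℝ) R, ENNReal.ofReal ((-v r) ^ 2 * r)
        = ∫⁻ r in Ioo (0:ℝ) R, ENNReal.ofReal
          (∑ i ∈ Finset.range n, (A i).indicator (fun s => (h i / (2 * π)) ^ 2 * s⁻¹) r) := by
          congr 1; ext r; congr 1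
          rw [neg_sq]
          simp only [hv, hg]
          rw [sum_indicator_sq_of_pairwise_disjoint _ _ hAdisj, Finset.sum_mul]
          refine Finset.sum_congr rfl fun i _ => ?_
          by_cases hr : r ∈ A i
          · rw [indicator_of_mem hr, indicator_of_mem hr]
            have := (hApos i r hr).ne'
            field_simp
          · rw [indicator_of_notMem hr, indicator_of_notMem hr, zero_mul]
      _ ≤ ∫⁻ r, ENNReal.ofReal
          (∑ i ∈ Finset.range n, (A i).indicator (fun s => (h i / (2 * π)) ^ 2 * s⁻¹) r) :=
          setLIntegral_le_lintegral _ _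
      _ = ENNReal.ofReal (∫ r,
          (∑ i ∈ Finset.range n, (A i).indicator (fun s => (h i / (2 * π)) ^ 2 * s⁻¹) r)) := by
          refine (ofReal_integral_eq_lintegral_ofReal (integrable_finsetSum _ fun i _ =>
            (integrable_indicator_iff (hAmeas i)).2 (intInv i _)) (Eventually.of_forall fun r =>
              Finset.sum_nonneg fun i _ => indicator_nonneg (hterm i) r)).symm
      _ ≤ _ := by
          refine le_of_eq ?_
          congr 1
          rw [integral_finsetSum _ fun i _ => (integrable_indicator_iff (hAmeas i)).2 (intInv i _)]
          refine Finset.sum_congr rfl fun i _ => ?_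
          rw [integral_indicator (hAmeas i), intA]
          have := (hh i).ne'
          field_simp
  have lower : ENNReal.ofReal (∑ k ∈ Finset.range n, (2 * (k : ℝ) + 1) * Δ ^ 2 *
      (ρ (k + 1) ^ 2 / 2)) ≤ ∫⁻ r in Ioo (0:ℝ) R, ENNReal.ofReal (w r ^ 2 * r) := by
    set q : ℕ → ℝ → ℝ := fun k =>
      (Ioo 0 (ρ (k + 1))).indicator (fun r => (2 * (k : ℝ) + 1) * Δ ^ 2 * r) with hq
    have qint : ∀ k, Integrable (q k) := fun k => by
      refine (integrable_indicator_iff measurableSet_Ioo).2 ?_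
      exact (Continuous.integrableOn_Icc (by fun_prop)).mono_set Ioo_subset_Icc_self
    have qnn : ∀ k r, 0 ≤ q k r := fun k r => indicator_nonneg
      (fun r hr => mul_nonneg (by positivity) hr.1.le) r
    have qbound : ∀ r, 0 < r → ∀ m ≤ n, ∑ k ∈ Finset.range m, q k r ≤ w r ^ 2 * r := by
      intro r hr m
      induction m with
      | zero => intro _; simpa using mul_nonneg (sq_nonneg _) hr.le
      | succ m ih =>
        intro hm
        by_cases hrm : r < ρ (m + 1)
        · have h1 : ∑ k ∈ Finset.range (m + 1), q k r ≤
              ∑ k ∈ Finset.range (m + 1), (2 * (k : ℝ) + 1) * Δ ^ 2 * r :=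
            Finset.sum_le_sum fun k _ => indicator_apply_le'
              (fun _ => le_rfl) (fun _ => by positivity)
          have h2 : ∀ m : ℕ, ∑ k ∈ Finset.range m, (2 * (k : ℝ) + 1) * Δ ^ 2 * r
              = (m * Δ) ^ 2 * r := by
            intro m
            induction m with
            | zero => simp
            | succ m ih => rw [Finset.sum_range_succ, ih]; push_cast; ring
          rw [h2] at h1
          refine h1.trans (mul_le_mul_of_nonneg_right ?_ hr.le)
          exact pow_le_pow_left₀ (by positivity) (w_ge _ hm r hrm.le) 2
        · rw [Finset.sum_range_succ, hq]
          simp only []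
          rw [indicator_of_notMem (fun hx => hrm hx.2), add_zero]
          exact ih (Nat.le_of_succ_le hm)
    calc ENNReal.ofReal (∑ k ∈ Finset.range n, (2 * (k : ℝ) + 1) * Δ ^ 2 * (ρ (k + 1) ^ 2 / 2))
        = ENNReal.ofReal (∫ r in Ioo (0:ℝ) R, ∑ k ∈ Finset.range n, q k r) := by
          congr 1
          rw [integral_finsetSum _ fun i _ => (qint i).integrableOn]
          refine Finset.sum_congr rfl fun k _ => ?_
          rw [setIntegral_indicator measurableSet_Ioo, inter_eq_right.2
            (Ioo_subset_Ioo_right (ρle _)), ← integral_Ioc_eq_integral_Ioo,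
            ← intervalIntegral.integral_of_le (ρpos _).le,
            intervalIntegral.integral_const_mul, integral_id]
          ring
      _ = ∫⁻ r in Ioo (0:ℝ) R, ENNReal.ofReal (∑ k ∈ Finset.range n, q k r) :=
          ofReal_integral_eq_lintegral_ofReal (integrable_finsetSum _ fun i _ =>
            (qint i).integrableOn) (Eventually.of_forall fun r =>
              Finset.sum_nonneg fun i _ => qnn i r)
      _ ≤ _ := setLIntegral_mono' measurableSet_Ioo fun r hr =>
          ENNReal.ofReal_le_ofReal (qbound r hr.1 n le_rfl)
  have final := (mul_le_mul_right lower (ENNReal.ofReal κ)).trans (key.trans upper)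
  rw [← ENNReal.ofReal_mul hκ.le, ENNReal.ofReal_le_ofReal_iff
    (Finset.sum_nonneg fun i _ => by have := hh i; positivity), ← Finset.sum_div,
    le_div_iff₀ (by positivity)] at final
  refine le_trans (le_of_eq ?_) final
  rw [Finset.mul_sum, Finset.mul_sum, Finset.sum_mul]
  refine Finset.sum_congr rfl fun k _ => ?_
  have : ρ (k + 1) ^ 2 = R ^ 2 * exp (-(4 * π) * ∑ i ∈ Finset.range (k + 1), Δ / h i) := by
    simp only [hρ]
    rw [mul_pow, ← exp_nat_mul]
    congr 2; push_cast; ring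
  rw [this]; ring

theorem harmCap_nonneg (F Ω : Set (EuclideanSpace ℝ (Fin 2))) : 0 ≤ harmCap F Ω := by
  refine Real.sInf_nonneg ?_
  rintro r ⟨u, -, -, rfl⟩
  exact integral_nonneg fun x => sq_nonneg _

theorem harmCap_le {F Ω : Set (EuclideanSpace ℝ (Fin 2))} {v : EuclideanSpace ℝ (Fin 2) → ℝ}
    (hv : TestFun Ω v) (h1 : ∀ x ∈ F, 1 ≤ v x) :
    harmCap F Ω ≤ ∫ x in Ω, ‖fderiv ℝ v x‖ ^ 2 := by
  refine csInf_le ⟨0, ?_⟩ ⟨v, hv, h1, rfl⟩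
  rintro r ⟨u, -, -, rfl⟩
  exact integral_nonneg fun x => sq_nonneg _

theorem harmCap_empty (Ω : Set (EuclideanSpace ℝ (Fin 2))) : harmCap ∅ Ω = 0 := by
  refine le_antisymm ?_ (harmCap_nonneg _ _)
  refine (harmCap_le (v := 0) ⟨contDiff_const, HasCompactSupport.zero, ?_⟩ (by simp)).trans ?_
  · simp [tsupport]
  · simp [show (0 : EuclideanSpace ℝ (Fin 2) → ℝ) = fun _ => 0 from rfl]

theorem TestFun.integrable_sq_fderiv {Ω : Set (EuclideanSpace ℝ (Fin 2))}
    {u : EuclideanSpace ℝ (Fin 2) → ℝ} (hu : TestFun Ω u) :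
    Integrable (fun x => ‖fderiv ℝ u x‖ ^ 2) := by
  refine Continuous.integrable_of_hasCompactSupport
    ((hu.1.continuous_fderiv (by simp)).norm.pow 2) ?_
  exact (hu.2.1.fderiv ℝ).comp_left (g := fun L => ‖L‖ ^ 2) (by simp)

theorem TestFun.comp {Ω : Set (EuclideanSpace ℝ (Fin 2))}
    {u : EuclideanSpace ℝ (Fin 2) → ℝ} (hu : TestFun Ω u) {B : ℝ → ℝ}
    (hB : ContDiff ℝ (⊤ : ℕ∞) B) (hB0 : B 0 = 0) : TestFun Ω (B ∘ u) :=
  ⟨hB.comp hu.1, hu.2.1.comp_left hB0, (tsupport_comp_subset hB0 u).trans hu.2.2⟩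

/-- The capacity of a superlevel set is at most the energy of a truncation of `|u|`. -/
theorem TestFun.harmCap_superlevel_le {Ω : Set (EuclideanSpace ℝ (Fin 2))}
    {u : EuclideanSpace ℝ (Fin 2) → ℝ} (hu : TestFun Ω u) {P : ℝ → ℝ}
    (hP : ContDiff ℝ (⊤ : ℕ∞) P) {t : ℝ} (ht : 0 ≤ t) (hPt : Function.support P ⊆ Ioc 0 t)
    (hP1 : ∫ s, P s = 1) :
    harmCap {x ∈ Ω | t ≤ |u x|} Ω ≤ ∫ x in Ω, P |u x| ^ 2 * ‖fderiv ℝ u x‖ ^ 2 := by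
  have hP0 : ∀ s ≤ 0, P s = 0 := fun s hs => by
    by_contra h
    exact absurd (hPt h).1 hs.not_gt
  set B : ℝ → ℝ := fun s => (∫ r in 0..s, P r) + ∫ r in 0..-s, P r with hBdef
  have hBder : ∀ s, HasDerivAt B (P s - P (-s)) s := by
    intro s
    have h1 := (hP.continuous.integral_hasStrictDerivAt 0 s).hasDerivAt
    have h2 := ((hP.continuous.integral_hasStrictDerivAt 0 (-s)).hasDerivAt).comp s
      (hasDerivAt_neg s)
    exact (h1.add h2).congr_deriv (by ring)
  have hBder' : deriv B = fun s => P s - P (-s) := funext fun s => (hBder s).deriv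
  have hBsmooth : ContDiff ℝ (⊤ : ℕ∞) B := by
    rw [contDiff_infty_iff_deriv, hBder']
    exact ⟨fun s => (hBder s).differentiableAt, hP.sub (hP.comp contDiff_neg)⟩
  have hBsq : ∀ s, (P s - P (-s)) ^ 2 = P |s| ^ 2 := by
    intro s
    rcases le_total 0 s with h | h
    · rw [abs_of_nonneg h, hP0 (-s) (by linarith), sub_zero]
    · rw [abs_of_nonpos h, hP0 s h, zero_sub, neg_sq]
  have int_pos : ∀ s, t ≤ s → ∫ r in 0..s, P r = 1 := fun s hs => by
    rw [intervalIntegral.integral_eq_integral_of_support_subset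
      (hPt.trans (Ioc_subset_Ioc_right hs)), hP1]
  have int_neg : ∀ s ≤ 0, ∫ r in 0..s, P r = 0 := fun s hs => by
    rw [intervalIntegral.integral_congr (g := fun _ => 0) fun r hr => hP0 r ?_]
    · simp
    · rw [uIcc_of_ge hs] at hr
      exact hr.2
  have hB1 : ∀ s, t ≤ |s| → B s = 1 := by
    intro s hs
    rcases le_total 0 s with h | h
    · rw [abs_of_nonneg h] at hs
      simp only [hBdef]
      rw [int_pos s hs, int_neg (-s) (by linarith), add_zero]
    · rw [abs_of_nonpos h] at hs
      simp only [hBdef]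
      rw [int_pos (-s) hs, int_neg s h, zero_add]
  refine (harmCap_le (hu.comp hBsmooth (by simp [hBdef])) fun x hx => (hB1 _ hx.2).ge).trans_eq ?_
  congr 1; ext x
  rw [((hBder (u x)).comp_hasFDerivAt x
    ((hu.1.differentiable (by simp)) x).hasFDerivAt).fderiv, norm_smul, mul_pow, Real.norm_eq_abs,
    sq_abs, hBsq]

/-- The open set on which `|u|` lies strictly between `i * Δ` and `(i + 1) * Δ`. -/
def levelBand (u : EuclideanSpace ℝ (Fin 2) → ℝ) (Δ : ℝ) (i : ℕ) :
    Set (EuclideanSpace ℝ (Fin 2)) :=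
  {x | |u x| ∈ Ioo (i * Δ) ((i + 1 : ℕ) * Δ)}

theorem measurableSet_levelBand {u : EuclideanSpace ℝ (Fin 2) → ℝ} (hu : Continuous u)
    (Δ : ℝ) (i : ℕ) : MeasurableSet (levelBand u Δ i) :=
  (isOpen_Ioo.preimage hu.abs).measurableSet

theorem pairwise_disjoint_Ioo_mul {Δ : ℝ} (hΔ : 0 < Δ) :
    Pairwise (fun i j : ℕ => Disjoint (Ioo (i * Δ) ((i + 1 : ℕ) * Δ))
      (Ioo (j * Δ) ((j + 1 : ℕ) * Δ))) := by
  have : Monotone (fun i : ℕ => (i : ℝ) * Δ) := fun i j hij =>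
    mul_le_mul_of_nonneg_right (Nat.cast_le.2 hij) hΔ.le
  exact this.pairwise_disjoint_on_Ioo_succ

theorem TestFun.harmCap_mul_sum_le_one {Ω : Set (EuclideanSpace ℝ (Fin 2))}
    {u : EuclideanSpace ℝ (Fin 2) → ℝ} (hu : TestFun Ω u) {Δ : ℝ} (hΔ : 0 < Δ) {h : ℕ → ℝ}
    (hh : ∀ i, 0 < h i)
    (hν : ∀ i, ∫ x in Ω, (levelBand u Δ i).indicator (fun x => ‖fderiv ℝ u x‖ ^ 2) x ≤ Δ * h i)
    {k : ℕ} {t : ℝ} (ht : k * Δ ≤ t) :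
    harmCap {x ∈ Ω | t ≤ |u x|} Ω * ∑ i ∈ Finset.range k, Δ / h i ≤ 1 := by
  rcases Nat.eq_zero_or_pos k with rfl | hk
  · simp
  set τ := ∑ i ∈ Finset.range k, Δ / h i with hτ
  have hτpos : 0 < τ := Finset.sum_pos (fun i _ => div_pos hΔ (hh i)) (by simpa using hk.ne')
  set C := harmCap {x ∈ Ω | t ≤ |u x|} Ω with hC
  suffices H : ∀ θ ∈ Ioo (0:ℝ) 1, θ ^ 2 * (C * τ) ≤ 1 by
    have hlim : Tendsto (fun θ : ℝ => θ ^ 2 * (C * τ)) (𝓝[<] 1) (𝓝 (1 ^ 2 * (C * τ))) :=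
      ((continuous_id.pow 2).mul continuous_const).continuousAt.tendsto.mono_left
        nhdsWithin_le_nhds
    simpa using le_of_tendsto hlim (by
      filter_upwards [Ioo_mem_nhdsLT (show (0:ℝ) < 1 by norm_num)] with θ hθ using H θ hθ)
  rintro θ ⟨hθ0, hθ1⟩
  let b : ∀ i : ℕ, ContDiffBump ((i : ℝ) * Δ + Δ / 2) := fun i =>
    { rIn := θ * (Δ / 2), rOut := Δ / 2, rIn_pos := by positivity, rIn_lt_rOut := by nlinarith }
  set φ : ℕ → ℝ → ℝ := fun i => (b i).normed volume with hφ
  have φsupp : ∀ i, Function.support (φ i) = Ioo (i * Δ) ((i + 1 : ℕ) * Δ) := fun i => by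
    simp only [hφ]
    rw [(b i).support_normed_eq, Real.ball_eq_Ioo]
    congr 1 <;> simp only [b] <;> push_cast <;> ring
  have φnn : ∀ i s, 0 ≤ φ i s := fun i s => (b i).nonneg_normed s
  have φle : ∀ i s, φ i s ≤ 1 / (θ * Δ) := fun i s => by
    refine ((b i).normed_le_div_measure_closedBall_rIn volume s).trans_eq ?_
    rw [measureReal_def, Real.volume_closedBall, ENNReal.toReal_ofReal (by positivity)]
    simp only [b]
    congr 1; ring
  have φint : ∀ i, Integrable (φ i) := fun i => (b i).integrable_normed
  set c : ℕ → ℝ := fun i => Δ / h i / τ with hc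
  set P : ℝ → ℝ := fun s => ∑ i ∈ Finset.range k, c i * φ i s with hP
  have hPsmooth : ContDiff ℝ (⊤ : ℕ∞) P :=
    ContDiff.sum fun i _ => contDiff_const.mul (b i).contDiff_normed
  have hPint : ∫ s, P s = 1 := by
    rw [integral_finsetSum _ fun i _ => (φint i).const_mul _]
    have : ∀ i ∈ Finset.range k, ∫ s, c i * φ i s = c i := fun i _ => by
      rw [integral_const_mul, (b i).integral_normed, mul_one]
    rw [Finset.sum_congr rfl this, ← Finset.sum_div, div_self hτpos.ne']
  have hPsupp : Function.support P ⊆ Ioc 0 t := by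
    intro s hs
    obtain ⟨i, hi, hne⟩ := Finset.exists_ne_zero_of_sum_ne_zero hs
    have h1 : s ∈ Ioo ((i : ℝ) * Δ) ((i + 1 : ℕ) * Δ) := φsupp i ▸ right_ne_zero_of_mul hne
    refine ⟨lt_of_le_of_lt (by positivity) h1.1, h1.2.le.trans (le_trans ?_ ht)⟩
    exact mul_le_mul_of_nonneg_right (Nat.cast_le.2 (Finset.mem_range.1 hi)) hΔ.le
  have hPsq : ∀ s, P s ^ 2 ≤ ∑ i ∈ Finset.range k,
      (Ioo ((i : ℝ) * Δ) ((i + 1 : ℕ) * Δ)).indicator (fun _ => (c i / (θ * Δ)) ^ 2) s := by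
    intro s
    have h1 : P s = ∑ i ∈ Finset.range k,
        (Ioo ((i : ℝ) * Δ) ((i + 1 : ℕ) * Δ)).indicator (fun r => c i * φ i r) s := by
      refine Finset.sum_congr rfl fun i _ => ?_
      by_cases hs : s ∈ Ioo ((i : ℝ) * Δ) ((i + 1 : ℕ) * Δ)
      · rw [indicator_of_mem hs]
      · rw [indicator_of_notMem hs]
        rw [← φsupp i, Function.notMem_support] at hs
        rw [hs, mul_zero]
    rw [h1, sum_indicator_sq_of_pairwise_disjoint _ _ (pairwise_disjoint_Ioo_mul hΔ)]
    refine Finset.sum_le_sum fun i _ => indicator_le_indicator ?_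
    have hci : 0 ≤ c i := (div_pos (div_pos hΔ (hh i)) hτpos).le
    refine pow_le_pow_left₀ (mul_nonneg hci (φnn i s)) ?_ 2
    rw [div_eq_mul_one_div]
    exact mul_le_mul_of_nonneg_left (φle i s) hci
  have ht0 : 0 ≤ t := le_trans (by positivity) ht
  have hint := hu.integrable_sq_fderiv
  have hbandint : ∀ i, IntegrableOn ((levelBand u Δ i).indicator
      (fun x => ‖fderiv ℝ u x‖ ^ 2)) Ω := fun i =>
    (hint.indicator (measurableSet_levelBand hu.1.continuous Δ i)).integrableOn
  have main : C ≤ ∑ i ∈ Finset.range k, (c i / (θ * Δ)) ^ 2 * (Δ * h i) := by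
    calc C ≤ ∫ x in Ω, P |u x| ^ 2 * ‖fderiv ℝ u x‖ ^ 2 :=
          hu.harmCap_superlevel_le hPsmooth ht0 hPsupp hPint
      _ ≤ ∫ x in Ω, ∑ i ∈ Finset.range k, (c i / (θ * Δ)) ^ 2 *
            (levelBand u Δ i).indicator (fun x => ‖fderiv ℝ u x‖ ^ 2) x := by
          refine integral_mono_of_nonneg (Eventually.of_forall fun x => by positivity)
            (integrable_finsetSum _ fun i _ => (hbandint i).const_mul _)
            (Eventually.of_forall fun x => ?_)
          refine (mul_le_mul_of_nonneg_right (hPsq |u x|) (sq_nonneg _)).trans_eq ?_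
          rw [Finset.sum_mul]
          refine Finset.sum_congr rfl fun i _ => ?_
          by_cases hx : x ∈ levelBand u Δ i
          · rw [indicator_of_mem hx, indicator_of_mem
              (show |u x| ∈ Ioo ((i : ℝ) * Δ) ((i + 1 : ℕ) * Δ) from hx)]
          · rw [indicator_of_notMem hx, indicator_of_notMem
              (show |u x| ∉ Ioo ((i : ℝ) * Δ) ((i + 1 : ℕ) * Δ) from hx)]
            simp
      _ = ∑ i ∈ Finset.range k, (c i / (θ * Δ)) ^ 2 *
            ∫ x in Ω, (levelBand u Δ i).indicator (fun x => ‖fderiv ℝ u x‖ ^ 2) x := by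
          rw [integral_finsetSum _ fun i _ => (hbandint i).const_mul _]
          exact Finset.sum_congr rfl fun i _ => integral_const_mul _ _
      _ ≤ _ := Finset.sum_le_sum fun i _ => mul_le_mul_of_nonneg_left (hν i) (sq_nonneg _)
  have hsum : ∑ i ∈ Finset.range k, (c i / (θ * Δ)) ^ 2 * (Δ * h i) = 1 / (θ ^ 2 * τ) := by
    have : ∀ i ∈ Finset.range k, (c i / (θ * Δ)) ^ 2 * (Δ * h i) =
        1 / (θ ^ 2 * τ ^ 2) * (Δ / h i) := fun i _ => by
      have := (hh i).ne'
      simp only [hc]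
      field_simp
    rw [Finset.sum_congr rfl this, ← Finset.mul_sum, ← hτ]
    field_simp
  rw [hsum, le_div_iff₀ (by positivity)] at main
  linarith

theorem TestFun.sum_levelBand_le {Ω : Set (EuclideanSpace ℝ (Fin 2))}
    {u : EuclideanSpace ℝ (Fin 2) → ℝ} (hu : TestFun Ω u) {Δ : ℝ} (hΔ : 0 < Δ) (n : ℕ) :
    ∑ i ∈ Finset.range n,
      ∫ x in Ω, (levelBand u Δ i).indicator (fun x => ‖fderiv ℝ u x‖ ^ 2) x ≤
    ∫ x in Ω, ‖fderiv ℝ u x‖ ^ 2 := by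
  have hint := hu.integrable_sq_fderiv
  have hmeas := measurableSet_levelBand hu.1.continuous Δ
  have hdisj : Pairwise (fun i j => Disjoint (levelBand u Δ i) (levelBand u Δ j)) :=
    fun i j hij => (pairwise_disjoint_Ioo_mul hΔ hij).preimage fun x => |u x|
  rw [← integral_finsetSum _ fun i _ => (hint.indicator (hmeas i)).integrableOn]
  refine integral_mono (integrable_finsetSum _ fun i _ => (hint.indicator (hmeas i)).integrableOn)
    hint.integrableOn fun x => ?_
  rw [← sum_indicator_sq_of_pairwise_disjoint _ _ hdisj fun _ x => ‖fderiv ℝ u x‖]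
  refine pow_le_pow_left₀ (Finset.sum_nonneg fun i _ =>
    indicator_nonneg (fun _ _ => norm_nonneg _) _) ?_ 2
  rw [← Finset.indicator_biUnion_apply _ _ fun i _ j _ hij => hdisj hij]
  exact indicator_le_self' (fun _ _ => norm_nonneg _) _

/-- The layer integral of `exp (-4π / cap)` is bounded by its upper Riemann sum, with the capacity
estimated through the energies of `u` on the level bands. -/
theorem TestFun.integral_capacity_exp_le {Ω : Set (EuclideanSpace ℝ (Fin 2))}
    {u : EuclideanSpace ℝ (Fin 2) → ℝ} (hu : TestFun Ω u) {M : ℝ} (hM : ∀ x, |u x| < M)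
    {Δ : ℝ} (hΔ : 0 < Δ) {h : ℕ → ℝ} (hh : ∀ i, 0 < h i)
    (hν : ∀ i, ∫ x in Ω, (levelBand u Δ i).indicator (fun x => ‖fderiv ℝ u x‖ ^ 2) x ≤ Δ * h i)
    (n : ℕ) (hn : M ≤ n * Δ) :
    ∫⁻ t in Ioi (0:ℝ), ENNReal.ofReal
        ((if harmCap {x ∈ Ω | t ≤ |u x|} Ω = 0 then 0
          else Real.exp (-(4 * π) / harmCap {x ∈ Ω | t ≤ |u x|} Ω)) * (2 * t)) ≤
      ENNReal.ofReal (∑ k ∈ Finset.range n,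
        exp (-(4 * π) * ∑ i ∈ Finset.range k, Δ / h i) * (2 * ((k : ℝ) + 1) * Δ) * Δ) := by
  set e : ℕ → ℝ := fun k => exp (-(4 * π) * ∑ i ∈ Finset.range k, Δ / h i) with he
  set J : ℕ → Set ℝ := fun k => Ico (k * Δ) ((k + 1) * Δ) with hJ
  have hterm : ∀ k, 0 ≤ e k * (2 * ((k : ℝ) + 1) * Δ) := fun k =>
    mul_nonneg (exp_pos _).le (by positivity)
  have hpt : ∀ t ∈ Ioi (0:ℝ), ENNReal.ofReal
      ((if harmCap {x ∈ Ω | t ≤ |u x|} Ω = 0 then 0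
        else Real.exp (-(4 * π) / harmCap {x ∈ Ω | t ≤ |u x|} Ω)) * (2 * t)) ≤
      ∑ k ∈ Finset.range n, (J k).indicator
        (fun _ => ENNReal.ofReal (e k * (2 * ((k : ℝ) + 1) * Δ))) t := by
    intro t ht
    rw [mem_Ioi] at ht
    split_ifs with hc
    · simp
    have hpos : 0 < harmCap {x ∈ Ω | t ≤ |u x|} Ω :=
      (harmCap_nonneg _ _).lt_of_ne (Ne.symm hc)
    have htM : t < M := by
      by_contra hMt
      refine hc ?_
      rw [show {x ∈ Ω | t ≤ |u x|} = ∅ from eq_empty_of_forall_notMem fun x hx =>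
        absurd hx.2 ((hM x).trans_le (not_lt.1 hMt)).not_ge, harmCap_empty]
    have hk1 : (⌊t / Δ⌋₊ : ℝ) * Δ ≤ t := (le_div_iff₀ hΔ).1 (Nat.floor_le (by positivity))
    have hk2 : t < ((⌊t / Δ⌋₊ : ℝ) + 1) * Δ := (div_lt_iff₀ hΔ).1 (Nat.lt_floor_add_one _)
    have hkn : ⌊t / Δ⌋₊ < n := by
      rw [Nat.floor_lt (by positivity), div_lt_iff₀ hΔ]
      exact htM.trans_le hn
    generalize ⌊t / Δ⌋₊ = k at hk1 hk2 hkn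
    refine le_trans ?_ (Finset.single_le_sum (fun _ _ => zero_le) (Finset.mem_range.2 hkn))
    rw [indicator_of_mem (show t ∈ J k from ⟨hk1, hk2⟩)]
    refine ENNReal.ofReal_le_ofReal (mul_le_mul (exp_le_exp.2 ?_) (by linarith) (by positivity)
      (exp_pos _).le)
    have hcap := hu.harmCap_mul_sum_le_one hΔ hh hν hk1
    rw [div_le_iff₀ hpos]
    nlinarith [Real.pi_pos]
  refine (setLIntegral_mono' measurableSet_Ioi hpt).trans
    ((setLIntegral_le_lintegral _ _).trans_eq ?_)
  rw [lintegral_finsetSum _ fun k _ => measurable_const.indicator measurableSet_Ico,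
    ENNReal.ofReal_sum_of_nonneg fun k _ => mul_nonneg (hterm k) hΔ.le]
  refine Finset.sum_congr rfl fun k _ => ?_
  rw [lintegral_indicator_const measurableSet_Ico, Real.volume_Ico, ENNReal.ofReal_mul (hterm k)]
  congr 2
  ring

/-- the capacitary refinement of the Faber–Krahn inequality, `n = 2`.
The value `exp(−4π/cap)` is interpreted as `0` when the capacity vanishes. -/
theorem stmt_3 (Ω : Set (EuclideanSpace ℝ (Fin 2))) (hΩ : IsOpen Ω)
    (R : ℝ) (hR : 0 < R) (κ : ℝ) (hκ : 0 < κ)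
    -- `κ` satisfies the one-dimensional weighted Hardy-type inequality for all
    -- locally absolutely continuous `w` on `(0,R]` with `w(R) = 0`
    (hHardy : ∀ w w' : ℝ → ℝ,
      (∀ a b : ℝ, 0 < a → a ≤ b → b ≤ R →
        IntervalIntegrable w' volume a b ∧ w b - w a = ∫ s in a..b, w' s) →
      w R = 0 →
      ENNReal.ofReal κ * ∫⁻ ρ in Ioo (0:ℝ) R, ENNReal.ofReal (w ρ ^ 2 * ρ) ≤
        ∫⁻ ρ in Ioo (0:ℝ) R, ENNReal.ofReal (w' ρ ^ 2 * ρ))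
    (u : EuclideanSpace ℝ (Fin 2) → ℝ) (hu : TestFun Ω u) :
    ENNReal.ofReal (π * κ * R ^ 2) *
      ∫⁻ t in Ioi (0:ℝ), ENNReal.ofReal
        ((if harmCap {x ∈ Ω | t ≤ |u x|} Ω = 0 then 0
          else Real.exp (-(4 * π) / harmCap {x ∈ Ω | t ≤ |u x|} Ω)) * (2 * t)) ≤
      ∫⁻ x in Ω, ENNReal.ofReal (‖fderiv ℝ u x‖ ^ 2) := by
  obtain ⟨M, hM0, hM⟩ : ∃ M : ℝ, 0 < M ∧ ∀ x, |u x| < M := by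
    obtain ⟨C, hC⟩ := hu.1.continuous.bounded_above_of_compact_support hu.2.1
    exact ⟨max C 0 + 1, by positivity, fun x =>
      ((hC x).trans (le_max_left C 0)).trans_lt (lt_add_one _)⟩
  set E := ∫ x in Ω, ‖fderiv ℝ u x‖ ^ 2 with hE
  rw [← ofReal_integral_eq_lintegral_ofReal hu.integrable_sq_fderiv.integrableOn
    (Eventually.of_forall fun x => sq_nonneg _), ← hE]
  set a := π * κ * R ^ 2 with ha
  have ha0 : 0 ≤ a := by positivity
  have hlim : Tendsto (fun n : ℕ => ENNReal.ofReal (E + M * (M / ((n : ℝ) + 1)) +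
      a * (2 * (M / ((n : ℝ) + 1)) ^ 2 + 3 * M * (M / ((n : ℝ) + 1))))) atTop
      (𝓝 (ENNReal.ofReal (E + M * 0 + a * (2 * 0 ^ 2 + 3 * M * 0)))) := by
    have h0 : Tendsto (fun n : ℕ => M / ((n : ℝ) + 1)) atTop (𝓝 0) :=
      tendsto_const_nhds.div_atTop (tendsto_natCast_atTop_atTop.atTop_add tendsto_const_nhds)
    have hcont : Continuous (fun x : ℝ =>
        ENNReal.ofReal (E + M * x + a * (2 * x ^ 2 + 3 * M * x))) :=
      ENNReal.continuous_ofReal.comp (by fun_prop)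
    exact (hcont.tendsto 0).comp h0
  rw [show E + M * 0 + a * (2 * 0 ^ 2 + 3 * M * 0) = E by ring] at hlim
  refine ge_of_tendsto' hlim fun n => ?_
  set Δ := M / ((n : ℝ) + 1) with hΔdef
  have hΔ : 0 < Δ := by positivity
  have hnΔ : ((n : ℝ) + 1) * Δ = M := by
    rw [hΔdef]; field_simp
  set ν : ℕ → ℝ := fun i =>
    ∫ x in Ω, (levelBand u Δ i).indicator (fun x => ‖fderiv ℝ u x‖ ^ 2) x with hν
  have hνnn : ∀ i, 0 ≤ ν i := fun i =>
    integral_nonneg fun x => indicator_nonneg (fun _ _ => sq_nonneg _) x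
  set h : ℕ → ℝ := fun i => ν i / Δ + Δ with hh
  have hhpos : ∀ i, 0 < h i := fun i => add_pos_of_nonneg_of_pos (div_nonneg (hνnn i) hΔ.le) hΔ
  have hΔh : ∀ i, Δ * h i = ν i + Δ ^ 2 := fun i => by
    simp only [hh]; field_simp
  set e : ℕ → ℝ := fun k => exp (-(4 * π) * ∑ i ∈ Finset.range k, Δ / h i) with he
  have hcap := hu.integral_capacity_exp_le hM hΔ hhpos
    (fun i => by rw [hΔh]; exact le_add_of_nonneg_right (sq_nonneg Δ)) (n + 1)
    (by push_cast; exact hnΔ.ge)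
  refine (mul_le_mul_right hcap _).trans ?_
  rw [← ENNReal.ofReal_mul ha0]
  refine ENNReal.ofReal_le_ofReal ?_
  have hone : a * ∑ k ∈ Finset.range n, (2 * (k : ℝ) + 1) * Δ ^ 2 * e (k + 1) ≤
      ∑ i ∈ Finset.range n, Δ * h i := hardy_step_inequality hR hκ hHardy hΔ hhpos n
  have hband : ∑ i ∈ Finset.range n, ν i ≤ E := hu.sum_levelBand_le hΔ n
  have hsumh : ∑ i ∈ Finset.range n, Δ * h i ≤ E + M * Δ := by
    simp only [hΔh]
    rw [Finset.sum_add_distrib, Finset.sum_const, Finset.card_range, nsmul_eq_mul]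
    nlinarith
  have he0 : ∀ k, e k ≤ 1 := fun k => exp_le_one_iff.2 <| mul_nonpos_of_nonpos_of_nonneg
    (by linarith [Real.pi_pos]) (Finset.sum_nonneg fun i _ => (div_pos hΔ (hhpos i)).le)
  have hshift : ∑ k ∈ Finset.range (n + 1), e k * (2 * ((k : ℝ) + 1) * Δ) * Δ ≤
      ∑ k ∈ Finset.range n, (2 * (k : ℝ) + 1) * Δ ^ 2 * e (k + 1) +
        (2 * Δ ^ 2 + 3 * M * Δ) := by
    rw [Finset.sum_range_succ']
    have h1 : ∀ k ∈ Finset.range n, e (k + 1) * (2 * (((k + 1 : ℕ) : ℝ) + 1) * Δ) * Δ ≤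
        (2 * (k : ℝ) + 1) * Δ ^ 2 * e (k + 1) + 3 * Δ ^ 2 := fun k _ => by
      have := mul_le_mul_of_nonneg_left (he0 (k + 1)) (by positivity : 0 ≤ 3 * Δ ^ 2)
      push_cast
      linarith
    have h2 := Finset.sum_le_sum h1
    rw [Finset.sum_add_distrib, Finset.sum_const, Finset.card_range, nsmul_eq_mul] at h2
    have h3 := mul_le_mul_of_nonneg_left (he0 0) (by positivity : 0 ≤ 2 * Δ ^ 2)
    have h4 : (n : ℝ) * (3 * Δ ^ 2) ≤ 3 * M * Δ := by nlinarith
    push_cast at h2 ⊢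
    linarith
  linarith [mul_le_mul_of_nonneg_left hshift ha0]
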